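/- Let b, c > 0 and let w : ℝ → ℝ be a measurable function that is nonnegative almost everywhere and satisfies w(t) ≤ b·e^{−c|t|} for all t ∈ ℝ. Let l ≥ 1, let t₁, …, t_l ∈ ℂ be distinct complex numbers none of which is real, and let a₁, …, a_l ∈ ℂ be not all zero. Define T : ℂ[X] → ℂ by T(R) = ∫_ℝ w(t)·R(t) dt + Σ_{i=1}^{l} aᵢ·R(tᵢ). Then there exists a polynomial R ∈ ℂ[X] such that T(R·R̄) is not a nonnegative real number, where R̄ denotes the polynomial whose coefficients are the complex conjugates of the coefficients of R. -/

import Mathlib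

open MeasureTheory

open ProbabilityTheory Filter Topology

theorem eq_of_moments_eq {μ ν : Measure ℝ} [IsFiniteMeasure μ] [IsFiniteMeasure ν]
    (hμ : 0 ∈ interior (integrableExpSet id μ)) (hν : 0 ∈ interior (integrableExpSet id ν))
    (h : ∀ n : ℕ, ∫ x, x ^ n ∂μ = ∫ x, x ^ n ∂ν) : μ = ν := by
  have hU : IsPreconnected
      {z : ℂ | z.re ∈ interior (integrableExpSet id μ) ∩ interior (integrableExpSet id ν)} :=
    ((convex_integrableExpSet.interior.inter convex_integrableExpSet.interior).linear_preimage
      Complex.reLm).isPreconnected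
  have hseries : ∀ {ρ : Measure ℝ}, 0 ∈ interior (integrableExpSet id ρ) →
      HasFPowerSeriesAt (complexMGF id ρ)
        (FormalMultilinearSeries.ofScalars ℂ fun n ↦ ((∫ x, x ^ n ∂ρ : ℝ) : ℂ) / n.factorial)
        0 := by
    intro ρ hρ
    convert! (analyticAt_complexMGF (X := id) (μ := ρ) (z := 0) hρ).hasFPowerSeriesAt using 3
      with n
    rw [iteratedDeriv_complexMGF (X := id) (μ := ρ) (z := 0) hρ, ← integral_complex_ofReal]
    simp
  have heq : complexMGF id μ =ᶠ[𝓝 0] complexMGF id ν := by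
    have h1 := hseries hμ
    have h2 := hseries hν
    simp_rw [← h] at h2
    filter_upwards [h1.eventually_hasSum, h2.eventually_hasSum] with z hz1 hz2
    simpa using hz1.unique hz2
  have hon := AnalyticOnNhd.eqOn_of_preconnected_of_eventuallyEq
    (analyticOnNhd_complexMGF.mono fun z hz ↦ hz.1)
    (analyticOnNhd_complexMGF.mono fun z hz ↦ hz.2) hU (z₀ := 0) ⟨hμ, hν⟩ heq
  refine Measure.ext_of_charFun (funext fun s ↦ ?_)
  rw [← complexMGF_id_mul_I, ← complexMGF_id_mul_I]
  exact hon (by simpa using ⟨hμ, hν⟩)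

theorem integrable_withDensity_ofReal_iff {ν : Measure ℝ} {k f : ℝ → ℝ}
    (hk : AEMeasurable k ν) :
    Integrable f (ν.withDensity fun x ↦ ENNReal.ofReal (k x)) ↔
      Integrable (fun x ↦ max (k x) 0 * f x) ν := by
  rw [integrable_withDensity_iff_integrable_smul₀' hk.ennreal_ofReal (by simp)]
  simp [ENNReal.toReal_ofReal']

theorem ae_eq_zero_of_moments_eq_zero {ν : Measure ℝ} [SigmaFinite ν] {k : ℝ → ℝ}
    (hk : ∀ᶠ u in 𝓝 (0 : ℝ), Integrable (fun x ↦ k x * Real.exp (u * x)) ν)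
    (hmom : ∀ n : ℕ, ∫ x, k x * x ^ n ∂ν = 0) : k =ᵐ[ν] 0 := by
  have hk1 : Integrable k ν := by simpa using hk.self_of_nhds
  have hk2 : AEMeasurable (fun x ↦ -k x) ν := hk1.aemeasurable.neg
  have hpart : ∀ {f : ℝ → ℝ},
      (∀ᶠ u in 𝓝 (0 : ℝ), Integrable (fun x ↦ f x * Real.exp (u * x)) ν) →
      0 ∈ interior (integrableExpSet id (ν.withDensity fun x ↦ ENNReal.ofReal (f x))) := by
    intro f hf
    have hf1 : Integrable f ν := by simpa using hf.self_of_nhds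
    rw [mem_interior_iff_mem_nhds]
    filter_upwards [hf] with u hu
    refine (integrable_withDensity_ofReal_iff hf1.aemeasurable).2 (hu.pos_part.congr ?_)
    refine .of_forall fun x ↦ ?_
    simp only [id]
    rw [max_mul_of_nonneg _ _ (Real.exp_pos _).le, zero_mul]
  have hpos := hpart hk
  have hneg := hpart (f := fun x ↦ -k x) (hk.mono fun u hu ↦ by simpa using hu.neg)
  have := isFiniteMeasure_withDensity_ofReal hk1.2
  have := isFiniteMeasure_withDensity_ofReal hk1.neg.2
  have heq := eq_of_moments_eq hpos hneg fun n ↦ by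
    have i1 := (integrable_withDensity_ofReal_iff hk1.aemeasurable).1
      (integrable_pow_of_mem_interior_integrableExpSet hpos n)
    have i2 := (integrable_withDensity_ofReal_iff hk2).1
      (integrable_pow_of_mem_interior_integrableExpSet hneg n)
    rw [integral_withDensity_eq_integral_toReal_smul₀ hk1.aemeasurable.ennreal_ofReal (by simp),
      integral_withDensity_eq_integral_toReal_smul₀ hk2.ennreal_ofReal (by simp),
      ← sub_eq_zero]
    simp only [ENNReal.toReal_ofReal', smul_eq_mul]
    simp only [id] at i1 i2
    rw [← integral_sub i1 i2]
    refine Eq.trans ?_ (hmom n)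
    refine integral_congr_ae (.of_forall fun x ↦ ?_)
    simp only
    rw [← sub_mul, max_zero_sub_max_neg_zero_eq_self]
  rw [withDensity_eq_iff_of_sigmaFinite hk1.aemeasurable.ennreal_ofReal
    hk2.ennreal_ofReal] at heq
  filter_upwards [heq] with x hx
  have := congrArg ENNReal.toReal hx
  simp only [ENNReal.toReal_ofReal'] at this
  have h2 := max_zero_sub_max_neg_zero_eq_self (k x)
  simp_all

theorem memLp_two_eval_mul_exp {𝕜 : Type*} [RCLike 𝕜] {ν : Measure ℝ} {u : ℝ}
    (hu : 2 * u ∈ interior (integrableExpSet id ν)) (q : Polynomial 𝕜) :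
    MemLp (fun x : ℝ ↦ q.eval (x : 𝕜) * (Real.exp (u * x) : 𝕜)) 2 ν := by
  induction q using Polynomial.induction_on' with
  | add p q hp hq => simpa [add_mul] using! hp.add hq
  | monomial n a =>
    have hmeas : Continuous fun x : ℝ ↦ (x : 𝕜) ^ n * (Real.exp (u * x) : 𝕜) := by fun_prop
    have : MemLp (fun x : ℝ ↦ (x : 𝕜) ^ n * (Real.exp (u * x) : 𝕜)) 2 ν := by
      rw [memLp_two_iff_integrable_sq_norm hmeas.aestronglyMeasurable]
      refine (integrable_pow_abs_mul_exp_of_mem_interior_integrableExpSet hu (2 * n)).congr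
        (.of_forall fun x ↦ ?_)
      simp only [id, norm_mul, norm_pow, RCLike.norm_ofReal, Real.abs_exp]
      rw [mul_pow, ← pow_mul, mul_comm n 2, ← Real.exp_nat_mul]
      norm_num [mul_assoc]
    simpa [mul_assoc] using this.const_mul a

theorem memLp_two_eval {𝕜 : Type*} [RCLike 𝕜] {ν : Measure ℝ}
    (hν : 0 ∈ interior (integrableExpSet id ν)) (q : Polynomial 𝕜) :
    MemLp (fun x : ℝ ↦ q.eval (x : 𝕜)) 2 ν := by
  simpa using memLp_two_eval_mul_exp (u := 0) (by simpa using hν) q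

/-- The map sending a real polynomial `p` to the class of `M * p` in `L²(ν)`. -/
noncomputable def mulPolynomialToLp {ν : Measure ℝ} (hν : 0 ∈ interior (integrableExpSet id ν))
    (M : Polynomial ℝ) : Polynomial ℝ →ₗ[ℝ] Lp ℝ 2 ν where
  toFun p := (memLp_two_eval hν (M * p)).toLp
  map_add' p q := by
    rw [← MemLp.toLp_add]
    congr 1
    ext x
    simp [mul_add]
  map_smul' a p := by
    rw [RingHom.id_apply, ← MemLp.toLp_const_smul]
    congr 1
    ext x
    simp

theorem dense_range_mulPolynomialToLp {ν : Measure ℝ} [SigmaFinite ν]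
    (hν : 0 ∈ interior (integrableExpSet id ν)) {M : Polynomial ℝ} (hM : ∀ x, M.eval x ≠ 0) :
    (LinearMap.range (mulPolynomialToLp hν M)).topologicalClosure = ⊤ := by
  rw [Submodule.topologicalClosure_eq_top_iff, Submodule.eq_bot_iff]
  intro g hg
  rw [Submodule.mem_orthogonal] at hg
  have hk : (fun x ↦ M.eval x * g x) =ᵐ[ν] 0 := by
    refine ae_eq_zero_of_moments_eq_zero ?_ fun n ↦ ?_
    · have htend : Tendsto (fun u : ℝ ↦ 2 * u) (𝓝 0) (𝓝 0) := by
        simpa using (continuous_const_mul (2 : ℝ)).tendsto 0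
      filter_upwards [htend (isOpen_interior.mem_nhds hν)] with u hu
      refine ((memLp_two_eval_mul_exp (𝕜 := ℝ) hu M).integrable_mul (Lp.memLp g)).congr
        (.of_forall fun x ↦ ?_)
      simp
      ring
    · rw [← hg _ ⟨Polynomial.X ^ n, rfl⟩, L2.inner_def]
      refine integral_congr_ae ?_
      filter_upwards [(memLp_two_eval hν (M * Polynomial.X ^ n)).coeFn_toLp] with x hx
      simp only [mulPolynomialToLp, LinearMap.coe_mk, AddHom.coe_mk]
      rw [hx]
      simp
      ring
  rw [Lp.eq_zero_iff_ae_eq_zero]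
  filter_upwards [hk] with x hx
  exact (mul_eq_zero.1 hx).resolve_left (hM x)

theorem exists_polynomial_integral_sub_sq_lt {ν : Measure ℝ} [SigmaFinite ν]
    (hν : 0 ∈ interior (integrableExpSet id ν)) {M : Polynomial ℝ} (hM : ∀ x, M.eval x ≠ 0)
    {h : ℝ → ℝ} (hh : MemLp h 2 ν) {ε : ℝ} (hε : 0 < ε) :
    ∃ p : Polynomial ℝ, ∫ x, (h x - (M * p).eval x) ^ 2 ∂ν < ε := by
  have hmem : hh.toLp ∈ closure (LinearMap.range (mulPolynomialToLp hν M) : Set (Lp ℝ 2 ν)) := by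
    rw [← Submodule.topologicalClosure_coe, dense_range_mulPolynomialToLp hν hM]
    trivial
  obtain ⟨_, ⟨p, rfl⟩, hp⟩ := Metric.mem_closure_iff.1 hmem (√ε) (Real.sqrt_pos.2 hε)
  refine ⟨p, ?_⟩
  have hsq : ‖hh.toLp - mulPolynomialToLp hν M p‖ ^ 2 < ε := by
    rw [dist_eq_norm] at hp
    exact (Real.lt_sqrt (norm_nonneg _)).1 hp
  refine lt_of_eq_of_lt ?_ hsq
  rw [← real_inner_self_eq_norm_sq, L2.inner_def]
  refine integral_congr_ae ?_
  filter_upwards [(memLp_two_eval hν (M * p)).coeFn_toLp, hh.coeFn_toLp,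
    Lp.coeFn_sub hh.toLp (mulPolynomialToLp hν M p)] with x h1 h2 h3
  simp only [RCLike.ofReal_real_eq_id, id] at h1
  rw [h3, Pi.sub_apply, h2]
  simp only [mulPolynomialToLp, LinearMap.coe_mk, AddHom.coe_mk]
  simp only [RCLike.ofReal_real_eq_id, id]
  rw [h1]
  simp [sq]

theorem exists_polynomial_integral_norm_add_sq_lt {ν : Measure ℝ} [SigmaFinite ν]
    (hν : 0 ∈ interior (integrableExpSet id ν)) {M : Polynomial ℝ} (hM : ∀ x, M.eval x ≠ 0)
    (Q : Polynomial ℂ) {ε : ℝ} (hε : 0 < ε) :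
    ∃ P : Polynomial ℂ,
      ∫ x : ℝ, ‖(Q + M.map (algebraMap ℝ ℂ) * P).eval (x : ℂ)‖ ^ 2 ∂ν < ε := by
  have hQ : MemLp (fun x : ℝ ↦ Q.eval (x : ℂ)) 2 ν := memLp_two_eval hν Q
  have hre : MemLp (fun x : ℝ ↦ (Q.eval (x : ℂ)).re) 2 ν := hQ.re
  have him : MemLp (fun x : ℝ ↦ (Q.eval (x : ℂ)).im) 2 ν := hQ.im
  obtain ⟨p, hp⟩ := exists_polynomial_integral_sub_sq_lt hν hM hre (half_pos hε)
  obtain ⟨q, hq⟩ := exists_polynomial_integral_sub_sq_lt hν hM him (half_pos hε)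
  refine ⟨-(p.map (algebraMap ℝ ℂ) + Polynomial.C Complex.I * q.map (algebraMap ℝ ℂ)), ?_⟩
  have hip : Integrable (fun x : ℝ ↦ ((Q.eval (x : ℂ)).re - (M * p).eval x) ^ 2) ν :=
    (hre.sub (memLp_two_eval (𝕜 := ℝ) hν (M * p))).integrable_sq
  have hiq : Integrable (fun x : ℝ ↦ ((Q.eval (x : ℂ)).im - (M * q).eval x) ^ 2) ν :=
    (him.sub (memLp_two_eval (𝕜 := ℝ) hν (M * q))).integrable_sq
  calc _ = ∫ x : ℝ, (((Q.eval (x : ℂ)).re - (M * p).eval x) ^ 2 +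
        ((Q.eval (x : ℂ)).im - (M * q).eval x) ^ 2) ∂ν := by
        refine integral_congr_ae (.of_forall fun x ↦ ?_)
        have he : ∀ r : Polynomial ℝ, (r.map (algebraMap ℝ ℂ)).eval (x : ℂ) = (r.eval x : ℝ) :=
          fun r ↦ Polynomial.eval_map_apply (f := algebraMap ℝ ℂ) (p := r) x
        simp only [Polynomial.eval_add, Polynomial.eval_mul, Polynomial.eval_neg,
          Polynomial.eval_C, he]
        rw [Complex.sq_norm, Complex.normSq_apply]
        simp
        ring
    _ < ε := by
      rw [integral_add hip hiq]
      linarith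

theorem eval_mul_map_conj (R : Polynomial ℂ) (z : ℂ) :
    (R * R.map (starRingEnd ℂ)).eval z =
      R.eval z * starRingEnd ℂ (R.eval (starRingEnd ℂ z)) := by
  rw [Polynomial.eval_mul]
  congr 1
  simpa using (Polynomial.eval_map_apply (f := starRingEnd ℂ) (p := R) (starRingEnd ℂ z))

theorem integrable_exp_neg_mul_abs {δ : ℝ} (hδ : 0 < δ) :
    Integrable fun x : ℝ ↦ Real.exp (-δ * |x|) := by
  rw [← integrableOn_univ, ← Set.Iic_union_Ioi (a := (0 : ℝ)), integrableOn_union]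
  constructor
  · refine (integrableOn_exp_mul_Iic hδ 0).congr_fun (fun x hx ↦ ?_) measurableSet_Iic
    simp [abs_of_nonpos (Set.mem_Iic.1 hx)]
  · refine (integrableOn_exp_mul_Ioi (neg_lt_zero.2 hδ) 0).congr_fun (fun x hx ↦ ?_)
      measurableSet_Ioi
    simp [abs_of_pos (Set.mem_Ioi.1 hx)]

theorem zero_mem_interior_integrableExpSet_withDensity {b c : ℝ} (hb : 0 < b) (hc : 0 < c)
    {w : ℝ → ℝ} (hw_meas : Measurable w) (hw_bound : ∀ s : ℝ, w s ≤ b * Real.exp (-c * |s|)) :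
    0 ∈ interior (integrableExpSet id (volume.withDensity fun x ↦ ENNReal.ofReal (w x))) := by
  rw [mem_interior_iff_mem_nhds]
  filter_upwards [Ioo_mem_nhds (neg_lt_zero.2 hc) hc] with u hu
  refine (integrable_withDensity_ofReal_iff hw_meas.aemeasurable).2 ?_
  have hu' : 0 < c - |u| := sub_pos.2 (abs_lt.2 hu)
  refine ((integrable_exp_neg_mul_abs hu').const_mul b).mono'
    (by simp only [id]; fun_prop) (.of_forall fun x ↦ ?_)
  have h1 : max (w x) 0 ≤ b * Real.exp (-c * |x|) := max_le (hw_bound x) (by positivity)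
  have h2 : u * x ≤ |u| * |x| := by rw [← abs_mul]; exact le_abs_self _
  have h3 : |max (w x) 0| = max (w x) 0 := abs_of_nonneg (le_max_right _ _)
  simp only [id, norm_mul, Real.norm_eq_abs, Real.abs_exp, h3]
  calc max (w x) 0 * Real.exp (u * x)
      ≤ b * Real.exp (-c * |x|) * Real.exp (|u| * |x|) := by gcongr
    _ = b * Real.exp (-(c - |u|) * |x|) := by
      rw [mul_assoc, ← Real.exp_add]
      ring_nf

theorem exists_real_polynomial_vanishing {l : ℕ} (t : Fin l → ℂ) (ht_im : ∀ i, (t i).im ≠ 0) :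
    ∃ M : Polynomial ℝ, (∀ x, M.eval x ≠ 0) ∧
      ∀ i, (M.map (algebraMap ℝ ℂ)).eval (t i) = 0 ∧
        (M.map (algebraMap ℝ ℂ)).eval (starRingEnd ℂ (t i)) = 0 := by
  refine ⟨∏ i, ((Polynomial.X - Polynomial.C (t i).re) ^ 2 + Polynomial.C ((t i).im ^ 2)),
    fun x ↦ ?_, fun i ↦ ?_⟩
  · rw [Polynomial.eval_prod, Finset.prod_ne_zero_iff]
    intro i _
    simp only [Polynomial.eval_add, Polynomial.eval_pow, Polynomial.eval_sub, Polynomial.eval_X,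
      Polynomial.eval_C]
    have := ht_im i
    positivity
  · rw [Polynomial.map_prod, Polynomial.eval_prod, Polynomial.eval_prod]
    refine ⟨Finset.prod_eq_zero (Finset.mem_univ i) ?_,
      Finset.prod_eq_zero (Finset.mem_univ i) ?_⟩ <;>
    · simp only [Polynomial.map_add, Polynomial.map_pow, Polynomial.map_sub, Polynomial.map_X,
        Polynomial.map_C, Polynomial.eval_add, Polynomial.eval_pow, Polynomial.eval_sub,
        Polynomial.eval_X, Polynomial.eval_C]
      apply Complex.ext <;> simp [sq]

open ComplexConjugate in
theorem exists_mul_add_mul_conj_not_nonneg {a : ℂ} (ha : a ≠ 0) (A : ℂ) :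
    ∃ z : ℂ, ¬ ∃ ρ : ℝ, 0 ≤ ρ ∧ a * z + A * conj z = (ρ : ℂ) := by
  by_contra! h
  obtain ⟨r₁, h₁, e₁⟩ := h 1
  obtain ⟨r₂, h₂, e₂⟩ := h (-1)
  obtain ⟨r₃, h₃, e₃⟩ := h Complex.I
  obtain ⟨r₄, h₄, e₄⟩ := h (-Complex.I)
  have key : ∀ {r s : ℝ} {y : ℂ}, 0 ≤ r → 0 ≤ s → y = r → -y = s → y = 0 := by
    rintro r s y hr hs rfl hy
    have : -r = s := by exact_mod_cast hy
    norm_cast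
    linarith
  have k₁ := key h₁ h₂ e₁ (by rw [← e₂]; simp; ring)
  have k₂ := key h₃ h₄ e₃ (by rw [← e₄]; simp; ring)
  simp only [map_one, mul_one, Complex.conj_I] at k₁ k₂
  have k₃ : a - A = 0 := by
    have : (a - A) * Complex.I = 0 := by rw [← k₂]; ring
    exact (mul_eq_zero.1 this).resolve_right Complex.I_ne_zero
  exact ha (by linear_combination (k₁ + k₃) / 2)

open ComplexConjugate in
theorem exists_polynomial_sum_not_nonneg {l : ℕ} {t : Fin l → ℂ} (ht_inj : Function.Injective t)
    (ht_im : ∀ i, (t i).im ≠ 0) {a : Fin l → ℂ} (ha : a ≠ 0) :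
    ∃ Q : Polynomial ℂ, ¬ ∃ ρ : ℝ, 0 ≤ ρ ∧
      ∑ i, a i * (Q.eval (t i) * conj (Q.eval (conj (t i)))) = (ρ : ℂ) := by
  classical
  obtain ⟨j, hj⟩ := Function.ne_iff.1 ha
  have hne : conj (t j) ≠ t j := fun h ↦ ht_im j (Complex.conj_eq_iff_im.1 h)
  obtain ⟨z, hz⟩ := exists_mul_add_mul_conj_not_nonneg hj (∑ i, if t i = conj (t j) then a i else 0)
  let v : ℂ → ℂ := fun s ↦ if s = t j then z else if s = conj (t j) then 1 else 0
  let S : Finset ℂ := Finset.univ.image t ∪ Finset.univ.image fun i ↦ conj (t i)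
  have hQ : ∀ s ∈ S, (Lagrange.interpolate S id v).eval s = v s := fun s hs ↦
    Lagrange.eval_interpolate_at_node v (Set.injOn_id _) hs
  refine ⟨Lagrange.interpolate S id v, ?_⟩
  convert hz using 5
  rw [Finset.sum_mul, ← Finset.sum_erase_add _ _ (Finset.mem_univ j), add_comm,
    ← Finset.sum_erase_add _ (fun i ↦ (if t i = conj (t j) then a i else 0) * conj z)
      (Finset.mem_univ j)]
  simp only [hne.symm, if_false, zero_mul, add_zero]
  congr 1
  · rw [hQ _ (by simp [S]), hQ _ (by simp [S])]
    simp [v, hne]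
  · refine Finset.sum_congr rfl fun i hi ↦ ?_
    have hij : t i ≠ t j := ht_inj.ne (Finset.ne_of_mem_erase hi)
    rw [hQ _ (by simp [S]), hQ _ (by simp [S])]
    by_cases h : t i = conj (t j)
    · simp [v, h, hne]
    · have h' : conj (t i) ≠ t j := fun e ↦ h (by rw [← e, Complex.conj_conj])
      simp [v, h, hij]

theorem integral_mul_eval_mul_map_conj {w : ℝ → ℝ} (hw_meas : Measurable w)
    (hw_nonneg : ∀ᵐ s : ℝ ∂volume, 0 ≤ w s) (R : Polynomial ℂ) :
    ∫ s : ℝ, (w s : ℂ) * (R * R.map (starRingEnd ℂ)).eval (s : ℂ) =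
      ((∫ s : ℝ, ‖R.eval (s : ℂ)‖ ^ 2 ∂volume.withDensity fun x ↦ ENNReal.ofReal (w x) : ℝ) :
        ℂ) := by
  rw [integral_withDensity_eq_integral_toReal_smul hw_meas.ennreal_ofReal (by simp),
    ← integral_complex_ofReal]
  refine integral_congr_ae ?_
  filter_upwards [hw_nonneg] with s hs
  rw [eval_mul_map_conj, Complex.conj_ofReal, Complex.mul_conj, Complex.normSq_eq_norm_sq,
    ENNReal.toReal_ofReal hs]
  simp

/-- Let `w : ℝ → ℝ` be measurable, a.e. nonnegative, with `w(t) ≤ b·exp(−c|t|)`.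
Let `t₁, …, t_l` be distinct non-real complex numbers and `a₁, …, a_l` not all zero,
and let `T(R) = ∫ w(t)·R(t) dt + Σᵢ aᵢ·R(tᵢ)`. Then there is a polynomial `R ∈ ℂ[X]`
such that `T(R·R̄)` is not a nonnegative real number. -/
theorem exists_polynomial_T_not_nonneg
    (b c : ℝ) (hb : 0 < b) (hc : 0 < c)
    (w : ℝ → ℝ) (hw_meas : Measurable w)
    (hw_nonneg : ∀ᵐ s : ℝ ∂volume, 0 ≤ w s)
    (hw_bound : ∀ s : ℝ, w s ≤ b * Real.exp (-c * |s|))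
    (l : ℕ) (hl : 1 ≤ l)
    (t : Fin l → ℂ) (ht_inj : Function.Injective t) (ht_im : ∀ i, (t i).im ≠ 0)
    (a : Fin l → ℂ) (ha : a ≠ 0) :
    ∃ R : Polynomial ℂ,
      ¬ ∃ ρ : ℝ, 0 ≤ ρ ∧
        (∫ s : ℝ, (w s : ℂ) * (R * R.map (starRingEnd ℂ)).eval (s : ℂ)) +
          ∑ i, a i * (R * R.map (starRingEnd ℂ)).eval (t i) = (ρ : ℂ) := by
  obtain ⟨Q, hQ⟩ := exists_polynomial_sum_not_nonneg ht_inj ht_im ha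
  obtain ⟨M, hM, hMt⟩ := exists_real_polynomial_vanishing t ht_im
  have hν := zero_mem_interior_integrableExpSet_withDensity hb hc hw_meas hw_bound
  by_contra! hR
  have approx : ∀ ε : ℝ, 0 < ε → ∃ r ρ : ℝ, r < ε ∧ 0 ≤ ρ ∧ (r : ℂ) +
      ∑ i, a i * (Q.eval (t i) * starRingEnd ℂ (Q.eval (starRingEnd ℂ (t i)))) = (ρ : ℂ) := by
    intro ε hε
    obtain ⟨P, hP⟩ := exists_polynomial_integral_norm_add_sq_lt hν hM Q hε
    obtain ⟨ρ, hρ, hT⟩ := hR (Q + M.map (algebraMap ℝ ℂ) * P)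
    rw [integral_mul_eval_mul_map_conj hw_meas hw_nonneg] at hT
    refine ⟨_, ρ, hP, hρ, ?_⟩
    rw [← hT]
    congr 1
    refine Finset.sum_congr rfl fun i _ ↦ ?_
    rw [eval_mul_map_conj]
    simp [(hMt i).1, (hMt i).2]
  obtain ⟨r₁, ρ₁, -, -, h₁⟩ := approx 1 one_pos
  have hL : ∑ i, a i * (Q.eval (t i) * starRingEnd ℂ (Q.eval (starRingEnd ℂ (t i)))) =
      ((ρ₁ - r₁ : ℝ) : ℂ) := by
    rw [Complex.ofReal_sub, ← h₁, add_sub_cancel_left]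
  refine hQ ⟨ρ₁ - r₁, le_of_forall_pos_le_add fun ε hε ↦ ?_, hL⟩
  obtain ⟨r, ρ, hr, hρ, h⟩ := approx ε hε
  rw [hL] at h
  have : r + (ρ₁ - r₁) = ρ := by exact_mod_cast h
  linarith
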